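/- Let A ∈ ℝ^{m×n} (m < n) and M ∈ ℝ^{m×q} (m ≤ q) with rank(A) = rank(M) = m, let y ∈ ℝ^m, τ ≥ 0 and α ∈ [0,1]. Suppose A satisfies the restricted isometry property of order 2k with constant δ_{2k} < 1/√2. Then there exists a constant γ > 0, depending only on (A, M, y, τ, α), such that for every x ∈ ℝⁿ satisfying α‖Mᵀ(Ax − y)‖_∞ + (1−α)‖Mᵀ(Ax − y)‖₁ ≤ τ, there is an optimal solution x* of the Dantzig selector problem min{‖z‖₁ : α‖Mᵀ(Az − y)‖_∞ + (1−α)‖Mᵀ(Az − y)‖₁ ≤ τ} with ‖x − x*‖₂ ≤ 2γ·{ σ_k(x)₁ + cτ }. -/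

import Mathlib

open Matrix
open scoped Classical

/-- The ℓ₁ norm on `Fin n → ℝ`. -/
noncomputable def l1norm {n : ℕ} (x : Fin n → ℝ) : ℝ := ∑ i, |x i|

/-- The Euclidean (ℓ₂) norm on `Fin n → ℝ`. -/
noncomputable def l2norm {n : ℕ} (x : Fin n → ℝ) : ℝ := Real.sqrt (∑ i, (x i) ^ 2)

/-- The ℓ_∞ norm on `Fin n → ℝ`. -/
noncomputable def linfnorm {n : ℕ} (x : Fin n → ℝ) : ℝ := ⨆ i, |x i|

/-- The best `k`-term approximation error `σ_k(x)₁`. -/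
noncomputable def bestKTerm {n : ℕ} (k : ℕ) (x : Fin n → ℝ) : ℝ :=
  sInf {t : ℝ | ∃ u : Fin n → ℝ,
    (Finset.univ.filter (fun i => u i ≠ 0)).card ≤ k ∧ t = l1norm (x - u)}

/-- The induced `∞→1` operator norm. -/
noncomputable def opNormInfToOne {a b : ℕ} (Q : Matrix (Fin a) (Fin b) ℝ) : ℝ :=
  sSup {t : ℝ | ∃ x : Fin b → ℝ, linfnorm x ≤ 1 ∧ t = l1norm (Q.mulVec x)}

/-- The constant `c` of Theorem 3.2. -/
noncomputable def cConst {m n q : ℕ} (M : Matrix (Fin m) (Fin q) ℝ)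
    (A : Matrix (Fin m) (Fin n) ℝ) : ℝ :=
  sSup {t : ℝ | ∃ g : Fin m → Fin q, Function.Injective g ∧
    IsUnit (M.submatrix id g) ∧
    t = opNormInfToOne ((M.submatrix id g)⁻¹ * (A * Aᵀ)⁻¹ * A)}

/-- The residual `ϑ(x) = Mᵀ(Ax − y)`. -/
noncomputable def resid {m n q : ℕ} (A : Matrix (Fin m) (Fin n) ℝ)
    (M : Matrix (Fin m) (Fin q) ℝ) (y : Fin m → ℝ) (x : Fin n → ℝ) : Fin q → ℝ :=
  Mᵀ.mulVec (A.mulVec x - y)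

/-- `A` satisfies the RIP of order `s` with constant `δ`. -/
def RIP {m n : ℕ} (A : Matrix (Fin m) (Fin n) ℝ) (s : ℕ) (δ : ℝ) : Prop :=
  ∀ x : Fin n → ℝ, (Finset.univ.filter (fun i => x i ≠ 0)).card ≤ s →
    (1 - δ) * (l2norm x) ^ 2 ≤ (l2norm (A.mulVec x)) ^ 2 ∧
    (l2norm (A.mulVec x)) ^ 2 ≤ (1 + δ) * (l2norm x) ^ 2

lemma l2norm_sq {n : ℕ} (x : Fin n → ℝ) : l2norm x ^ 2 = ∑ i, x i ^ 2 :=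
  Real.sq_sqrt (Finset.sum_nonneg fun i _ => sq_nonneg (x i))

lemma l2norm_sq_eq_dotProduct {n : ℕ} (x : Fin n → ℝ) : l2norm x ^ 2 = x ⬝ᵥ x := by
  rw [l2norm_sq, dotProduct]
  exact Finset.sum_congr rfl fun i _ => sq (x i)

/-- A nonnegative function on a finite type has a set of `k` largest values. -/
lemma exists_finset_card_eq_threshold {ι : Type*} [Fintype ι] (f : ι → ℝ) (hf : ∀ i, 0 ≤ f i)
    {k : ℕ} (hk : 0 < k) (hkn : k ≤ Fintype.card ι) :
    ∃ (T : Finset ι) (θ : ℝ), T.card = k ∧ 0 ≤ θ ∧ (∀ i ∈ T, θ ≤ f i) ∧ ∀ i ∉ T, f i ≤ θ := by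
  obtain ⟨T, hT, hmax⟩ := Finset.exists_max_image (Finset.powersetCard k (Finset.univ : Finset ι))
    (fun T => ∑ i ∈ T, f i) (Finset.powersetCard_nonempty.2 (by simpa using hkn))
  have hTk : T.card = k := (Finset.mem_powersetCard.1 hT).2
  obtain ⟨i₀, hi₀, hmin⟩ := Finset.exists_min_image T f (Finset.card_pos.1 (hTk ▸ hk))
  refine ⟨T, f i₀, hTk, hf i₀, hmin, fun j hj => ?_⟩
  have hj' : j ∉ T.erase i₀ := fun h => hj (Finset.mem_of_mem_erase h)
  have h1 := hmax (insert j (T.erase i₀)) (Finset.mem_powersetCard.2 ⟨Finset.subset_univ _, by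
    rw [Finset.card_insert_of_notMem hj', Finset.card_erase_of_mem hi₀]; omega⟩)
  simp only [Finset.sum_insert hj'] at h1
  have h2 := Finset.add_sum_erase T f hi₀
  linarith

/-- Weights bounded by `a` and of total mass at most `k * a` do best on the `k` largest values. -/
lemma sum_mul_le_of_threshold {ι : Type*} [Fintype ι] {f w : ι → ℝ} {T : Finset ι} {θ a : ℝ}
    (hθ : 0 ≤ θ) (hT : ∀ i ∈ T, θ ≤ f i) (hTc : ∀ i ∉ T, f i ≤ θ)
    (hw : ∀ i, 0 ≤ w i) (hwa : ∀ i, w i ≤ a) (hsum : ∑ i, w i ≤ T.card * a) :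
    ∑ i, f i * w i ≤ a * ∑ i ∈ T, f i := by
  have h1 : ∑ i, (f i - θ) * w i ≤ ∑ i, if i ∈ T then (f i - θ) * a else 0 := by
    refine Finset.sum_le_sum fun i _ => ?_
    split_ifs with hi
    · exact mul_le_mul_of_nonneg_left (hwa i) (sub_nonneg.2 (hT i hi))
    · exact mul_nonpos_of_nonpos_of_nonneg (sub_nonpos.2 (hTc i hi)) (hw i)
  rw [Finset.sum_ite_mem, Finset.univ_inter, ← Finset.sum_mul, Finset.sum_sub_distrib,
    Finset.sum_const, nsmul_eq_mul] at h1
  simp only [sub_mul, Finset.sum_sub_distrib, ← Finset.mul_sum] at h1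
  have h2 := mul_le_mul_of_nonneg_left hsum hθ
  linarith

lemma RIP.null_of_dotProduct_nonpos {m n s : ℕ} {A : Matrix (Fin m) (Fin n) ℝ} {δ : ℝ}
    (hδ0 : 0 < δ) (hδ : δ < 1 / Real.sqrt 2) (hRIP : RIP A s δ) {v u : Fin n → ℝ}
    (hvu : ∀ a b : ℝ, (Finset.univ.filter fun i => (a • v + b • u) i ≠ 0).card ≤ s)
    (horth : v ⬝ᵥ u = 0) (hle : u ⬝ᵥ u ≤ v ⬝ᵥ v)
    (hneg : A *ᵥ v ⬝ᵥ A *ᵥ v + A *ᵥ v ⬝ᵥ A *ᵥ u ≤ 0) : v ⬝ᵥ v = 0 := by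
  have hr : Real.sqrt 2 ^ 2 = 2 := Real.sq_sqrt (by norm_num)
  have hr0 : 0 < Real.sqrt 2 := by positivity
  have hr1 : 1 < Real.sqrt 2 := by nlinarith
  have hr2 : Real.sqrt 2 < 3 / 2 := by nlinarith
  rw [lt_div_iff₀ hr0] at hδ
  set r := Real.sqrt 2
  have hvv : 0 ≤ v ⬝ᵥ v := by rw [← l2norm_sq_eq_dotProduct]; positivity
  have huv : u ⬝ᵥ v = 0 := by rw [dotProduct_comm, horth]
  have hcomm : A *ᵥ u ⬝ᵥ A *ᵥ v = A *ᵥ v ⬝ᵥ A *ᵥ u := dotProduct_comm _ _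
  have h1 := (hRIP _ (hvu 1 (r - 1))).1
  have h2 := (hRIP _ (hvu (3 - 2 * r) (-(r - 1)))).2
  simp only [l2norm_sq_eq_dotProduct, mulVec_add, mulVec_smul, dotProduct_add, add_dotProduct,
    smul_dotProduct, dotProduct_smul, smul_eq_mul, horth, huv, hcomm] at h1 h2
  generalize A *ᵥ v ⬝ᵥ A *ᵥ v = P at *
  generalize A *ᵥ v ⬝ᵥ A *ᵥ u = Q at *
  generalize A *ᵥ u ⬝ᵥ A *ᵥ u = R at *
  generalize v ⬝ᵥ v = X at *
  generalize u ⬝ᵥ u = U at *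
  have hsub : (1 - δ) * (X + (r - 1) ^ 2 * U) - (1 + δ) * ((3 - 2 * r) ^ 2 * X + (r - 1) ^ 2 * U)
      ≤ (1 - (3 - 2 * r) ^ 2) * P + 2 * (r - 1) * (1 + (3 - 2 * r)) * Q := by
    linarith
  have hPQ : (1 - (3 - 2 * r) ^ 2) * P + 2 * (r - 1) * (1 + (3 - 2 * r)) * Q
      = 4 * (r - 1) * (2 - r) * (P + Q) := by ring
  have hcoef : 0 ≤ 4 * (r - 1) * (2 - r) :=
    mul_nonneg (by linarith) (by linarith)
  have hPQ0 := mul_nonpos_of_nonneg_of_nonpos hcoef hneg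
  have hU : 2 * δ * (r - 1) ^ 2 * U ≤ 2 * δ * (r - 1) ^ 2 * X :=
    mul_le_mul_of_nonneg_left hle (by positivity)
  have hX : (1 - δ - (1 + δ) * (3 - 2 * r) ^ 2 - 2 * δ * (r - 1) ^ 2) * X ≤ 0 := by linarith
  have hc : 1 - δ - (1 + δ) * (3 - 2 * r) ^ 2 - 2 * δ * (r - 1) ^ 2
      = 4 * (3 - 2 * r) * (r - 2 * δ) := by
    linear_combination (4 - 6 * δ) * hr
  have hpos : 0 < 4 * (3 - 2 * r) * (r - 2 * δ) := by
    have : 0 < r - 2 * δ := by nlinarith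
    have : 0 < 3 - 2 * r := by linarith
    positivity
  rw [hc] at hX
  nlinarith

/-- The null space property: a restricted isometry constant `δ_{2k} < 1/√2` forbids nonzero
kernel vectors that concentrate on `k` coordinates. -/
lemma RIP.null_space_property {m n k : ℕ} {A : Matrix (Fin m) (Fin n) ℝ} {δ : ℝ}
    (hδ0 : 0 < δ) (hδ : δ < 1 / Real.sqrt 2) (hRIP : RIP A (2 * k) δ) {S : Finset (Fin n)}
    (hS : S.card ≤ k) {h : Fin n → ℝ} (hA : A *ᵥ h = 0)
    (hle : ∑ i ∈ Sᶜ, |h i| ≤ ∑ i ∈ S, |h i|) : h = 0 := by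
  rcases Nat.eq_zero_or_pos k with rfl | hk
  · obtain rfl : S = ∅ := Finset.card_eq_zero.1 (Nat.le_zero.1 hS)
    simp only [Finset.compl_empty, Finset.sum_empty] at hle
    have h0 := (Finset.sum_eq_zero_iff_of_nonneg fun i _ => abs_nonneg (h i)).1
      (le_antisymm hle (Finset.sum_nonneg fun i _ => abs_nonneg (h i)))
    exact funext fun i => abs_eq_zero.1 (h0 i (Finset.mem_univ i))
  have hzero : ∀ v : Fin n → ℝ, v ⬝ᵥ v = 0 → v = 0 := fun v => dotProduct_self_eq_zero.1
  by_cases hkn : n ≤ k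
  · refine hzero h (hRIP.null_of_dotProduct_nonpos hδ0 hδ (u := 0) (fun a b => ?_) (by simp) ?_
      (by simp [hA]))
    · exact (Finset.card_le_univ _).trans (by simp; omega)
    · rw [← l2norm_sq_eq_dotProduct, ← l2norm_sq_eq_dotProduct h, l2norm_sq]; simp; positivity
  have hk' : (0 : ℝ) < k := Nat.cast_pos.2 hk
  obtain ⟨T, θ, hTk, hθ, hT, hTc⟩ := exists_finset_card_eq_threshold (fun i => |h i|)
    (fun i => abs_nonneg _) hk (by simpa using Nat.le_of_not_le hkn)
  have hST : ∑ i ∈ S, |h i| ≤ ∑ i ∈ T, |h i| := by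
    have := sum_mul_le_of_threshold (f := fun i => |h i|) (w := fun i => if i ∈ S then 1 else 0)
      (a := 1) hθ hT hTc (fun i => by split_ifs <;> norm_num) (fun i => by split_ifs <;> norm_num)
      (by simpa [hTk] using hS)
    simpa using this
  have hsplitS := Finset.sum_add_sum_compl S fun i => |h i|
  have hsplitT := Finset.sum_add_sum_compl T fun i => |h i|
  obtain ⟨a, ha⟩ : ∃ a, ∑ i ∈ T, |h i| = k * a := ⟨(∑ i ∈ T, |h i|) / k, by field_simp⟩
  have ha0 : 0 ≤ a := by
    have := Finset.sum_nonneg fun i (_ : i ∈ T) => abs_nonneg (h i)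
    rw [ha] at this
    exact nonneg_of_mul_nonneg_right this hk'
  have hθa : θ ≤ a := by
    have := Finset.card_nsmul_le_sum T (fun i => |h i|) θ hT
    rw [ha, hTk, nsmul_eq_mul] at this
    exact le_of_mul_le_mul_left this hk'
  set v : Fin n → ℝ := fun i => if i ∈ T then h i else 0 with hv
  set w : Fin n → ℝ := fun i => if i ∈ T then 0 else |h i| with hw
  set g : Fin n → ℝ := (A *ᵥ v) ᵥ* A with hg
  obtain ⟨R, η, hRk, hη, hR, hRc⟩ := exists_finset_card_eq_threshold
    (fun i => if i ∈ T then 0 else |g i|)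
    (fun i => by split_ifs; exacts [le_rfl, abs_nonneg _]) hk
    (by simpa using Nat.le_of_not_le hkn)
  have hgw := sum_mul_le_of_threshold (w := w) (a := a) hη hR hRc
    (fun i => by simp only [hw]; split_ifs; exacts [le_rfl, abs_nonneg _])
    (fun i => by
      simp only [hw]
      split_ifs with hi
      exacts [ha0, (hTc i hi).trans hθa])
    (by
      have : ∑ i, w i = ∑ i ∈ Tᶜ, |h i| := by
        rw [← Finset.sum_add_sum_compl T, Finset.sum_eq_zero fun i hi => if_pos hi, zero_add]
        exact Finset.sum_congr rfl fun i hi => if_neg (Finset.mem_compl.1 hi)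
      rw [this, hRk, ← ha]
      linarith)
  set u : Fin n → ℝ := fun i => if i ∈ T then 0 else if i ∈ R then -(SignType.sign (g i) * a) else 0
    with hu
  have huv : g ⬝ᵥ u ≤ g ⬝ᵥ (h - v) := by
    have h1 : g ⬝ᵥ u = -(a * ∑ i ∈ R, if i ∈ T then 0 else |g i|) := by
      rw [dotProduct, Finset.mul_sum, ← Finset.sum_neg_distrib, ← Finset.univ_inter R,
        ← Finset.sum_ite_mem]
      refine Finset.sum_congr rfl fun i _ => ?_
      simp only [hu]
      split_ifs <;> simp
      rw [← self_mul_sign (g i)]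
      ring
    have h2 : -∑ i, (if i ∈ T then 0 else |g i|) * w i ≤ g ⬝ᵥ (h - v) := by
      rw [dotProduct, ← Finset.sum_neg_distrib]
      refine Finset.sum_le_sum fun i _ => ?_
      simp only [hw, hv, Pi.sub_apply]
      split_ifs
      · simp
      · rw [← abs_mul, sub_zero]; exact neg_abs_le _
    linarith
  have hAhv : g ⬝ᵥ (h - v) = -(A *ᵥ v ⬝ᵥ A *ᵥ v) := by
    rw [hg, ← dotProduct_mulVec, mulVec_sub, hA, zero_sub, dotProduct_neg]
  have hAu : A *ᵥ v ⬝ᵥ A *ᵥ u = g ⬝ᵥ u := by rw [hg, dotProduct_mulVec]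
  have hvv : v ⬝ᵥ v = ∑ i ∈ T, |h i| ^ 2 := by
    simp [dotProduct, hv, sq]
  have hka : k * a ^ 2 ≤ v ⬝ᵥ v := by
    have := sq_sum_le_card_mul_sum_sq (s := T) (f := fun i => |h i|)
    rw [ha, hTk, ← hvv] at this
    refine le_of_mul_le_mul_left ?_ hk'
    linarith
  have huu : u ⬝ᵥ u ≤ k * a ^ 2 := by
    have : u ⬝ᵥ u ≤ ∑ i ∈ R, a ^ 2 := by
      rw [dotProduct, ← Finset.univ_inter R, ← Finset.sum_ite_mem]
      refine Finset.sum_le_sum fun i _ => ?_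
      simp only [hu]
      split_ifs
      · simp; positivity
      · simp
      · rcases SignType.trichotomy (SignType.sign (g i)) with h | h | h <;> simp [h, sq]
        positivity
      · simp
    simpa [hRk] using this
  have hv0 : v ⬝ᵥ v = 0 := by
    refine hRIP.null_of_dotProduct_nonpos hδ0 hδ (u := u) (fun b c => ?_) ?_ (huu.trans hka) ?_
    · calc _ ≤ (T ∪ R).card := Finset.card_le_card fun i hi => by
            by_contra hcon
            rw [Finset.mem_union, not_or] at hcon
            simp [hv, hu, hcon.1, hcon.2] at hi
        _ ≤ T.card + R.card := Finset.card_union_le _ _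
        _ = 2 * k := by omega
    · refine Finset.sum_eq_zero fun i _ => ?_
      simp only [hv, hu]
      split_ifs <;> simp
    · linarith
  have ha' : a = 0 := by
    have : a ^ 2 ≤ 0 := by
      rw [hv0] at hka
      exact nonpos_of_mul_nonpos_right hka hk'
    exact pow_eq_zero_iff two_ne_zero |>.1 (le_antisymm this (sq_nonneg a))
  funext i
  by_cases hi : i ∈ T
  · have := congrFun (hzero v hv0) i
    simpa [hv, hi] using this
  · exact abs_nonpos_iff.1 (((hTc i hi).trans hθa).trans ha'.le)

lemma linfnorm_eq_norm {n : ℕ} (x : Fin n → ℝ) : linfnorm x = ‖x‖ := by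
  refine le_antisymm (Real.iSup_le (fun i => norm_le_pi_norm x i) (norm_nonneg x)) ?_
  exact (pi_norm_le_iff_of_nonneg (Real.iSup_nonneg fun i => abs_nonneg (x i))).2
    fun i => le_ciSup (f := fun i => |x i|) (Set.finite_range _).bddAbove i

lemma l1norm_nonneg {n : ℕ} (x : Fin n → ℝ) : 0 ≤ l1norm x :=
  Finset.sum_nonneg fun i _ => abs_nonneg (x i)

lemma continuous_l1norm {n : ℕ} : Continuous (l1norm : (Fin n → ℝ) → ℝ) := by
  unfold l1norm
  fun_prop

lemma norm_le_l1norm {n : ℕ} (x : Fin n → ℝ) : ‖x‖ ≤ l1norm x :=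
  (pi_norm_le_iff_of_nonneg (l1norm_nonneg x)).2 fun i =>
    Finset.single_le_sum (f := fun i => |x i|) (fun i _ => abs_nonneg (x i)) (Finset.mem_univ i)

lemma l2norm_le_sqrt_card_mul_norm {n : ℕ} (x : Fin n → ℝ) : l2norm x ≤ Real.sqrt n * ‖x‖ := by
  refine Real.sqrt_le_iff.2 ⟨by positivity, ?_⟩
  rw [mul_pow, Real.sq_sqrt (Nat.cast_nonneg n)]
  have := Finset.sum_le_card_nsmul Finset.univ (fun i => x i ^ 2) (‖x‖ ^ 2) fun i _ =>
    sq_le_sq' (abs_le.1 (norm_le_pi_norm x i)).1 (abs_le.1 (norm_le_pi_norm x i)).2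
  simpa using this

/-- A continuous positively homogeneous function that is positive away from `0` dominates a
multiple of the norm. -/
lemma exists_norm_le_mul_of_homogeneous {E : Type*} [NormedAddCommGroup E] [NormedSpace ℝ E]
    [FiniteDimensional ℝ E] {f : E → ℝ} (hf : Continuous f)
    (hsmul : ∀ t : ℝ, 0 ≤ t → ∀ x, f (t • x) = t * f x) (hpos : ∀ x ≠ 0, 0 < f x) :
    ∃ C : ℝ, 0 < C ∧ ∀ x, ‖x‖ ≤ C * f x := by
  have : ProperSpace E := FiniteDimensional.proper ℝ E
  have hf0 : f 0 = 0 := by simpa using hsmul 0 le_rfl 0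
  rcases (Metric.sphere (0 : E) 1).eq_empty_or_nonempty with he | hne
  · refine ⟨1, one_pos, fun x => ?_⟩
    by_cases hx : x = 0
    · simp [hx, hf0]
    · have : ‖x‖⁻¹ • x ∈ Metric.sphere (0 : E) 1 := by
        simp [norm_smul, inv_mul_cancel₀ (norm_ne_zero_iff.2 hx)]
      simp [he] at this
  · obtain ⟨x₀, hx₀, hmin⟩ := (isCompact_sphere (0 : E) 1).exists_isMinOn hne hf.continuousOn
    have hx₀' : 0 < f x₀ := hpos x₀ (ne_zero_of_mem_unit_sphere ⟨x₀, hx₀⟩)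
    refine ⟨(f x₀)⁻¹, inv_pos.2 hx₀', fun x => ?_⟩
    by_cases hx : x = 0
    · simp [hx, hf0]
    · have hmem : ‖x‖⁻¹ • x ∈ Metric.sphere (0 : E) 1 := by
        simp [norm_smul, inv_mul_cancel₀ (norm_ne_zero_iff.2 hx)]
      have h1 : f x₀ ≤ f (‖x‖⁻¹ • x) := hmin hmem
      rw [hsmul _ (by positivity), ← div_eq_inv_mul, le_div_iff₀ (norm_pos_iff.2 hx)] at h1
      rwa [← div_eq_inv_mul, le_div_iff₀ hx₀', mul_comm]

/-- A matrix of full row rank has an invertible maximal square submatrix. -/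
lemma exists_isUnit_submatrix_of_rank_eq {m q : ℕ} {M : Matrix (Fin m) (Fin q) ℝ}
    (hM : M.rank = m) :
    ∃ g : Fin m → Fin q, Function.Injective g ∧ IsUnit (M.submatrix id g) := by
  rw [rank_eq_finrank_span_cols] at hM
  obtain ⟨f, hf, -, hli⟩ := Submodule.exists_fun_fin_finrank_span_eq ℝ (Set.range M.col)
  choose g hg using hf
  refine ⟨g ∘ Fin.cast hM.symm, ?_, ?_⟩
  · refine Function.Injective.comp (fun i j hij => hli.injective ?_) (Fin.cast_injective _)
    rw [← hg, ← hg, hij]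
  · rw [← linearIndependent_cols_iff_isUnit]
    have hcol : (M.submatrix id (g ∘ Fin.cast hM.symm)).col = f ∘ Fin.cast hM.symm :=
      funext fun i => hg _
    rw [hcol]
    exact hli.comp _ (Fin.cast_injective hM.symm)

lemma mulVec_transpose_eq_zero_of_rank_eq {m q : ℕ} {M : Matrix (Fin m) (Fin q) ℝ}
    (hM : M.rank = m) {r : Fin m → ℝ} (hr : Mᵀ *ᵥ r = 0) : r = 0 := by
  obtain ⟨g, -, hg⟩ := exists_isUnit_submatrix_of_rank_eq hM
  refine mulVec_injective_of_isUnit ((isUnit_transpose _).2 hg) ?_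
  rw [mulVec_zero]
  exact funext fun i => congrFun hr (g i)

lemma le_opNormInfToOne {a b : ℕ} (Q : Matrix (Fin a) (Fin b) ℝ) {x : Fin b → ℝ}
    (hx : linfnorm x ≤ 1) : l1norm (Q *ᵥ x) ≤ opNormInfToOne Q := by
  refine le_csSup ?_ ⟨x, hx, rfl⟩
  have hcont : Continuous fun x : Fin b → ℝ => l1norm (Q *ᵥ x) :=
    continuous_l1norm.comp (by fun_prop)
  refine ((isCompact_closedBall (0 : Fin b → ℝ) 1).bddAbove_image hcont.continuousOn).mono ?_
  rintro t ⟨x, hx, rfl⟩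
  exact ⟨x, by simpa [← linfnorm_eq_norm] using hx, rfl⟩

lemma opNormInfToOne_pos {a b : ℕ} {Q : Matrix (Fin a) (Fin b) ℝ} (hQ : Q ≠ 0) :
    0 < opNormInfToOne Q := by
  obtain ⟨j, hj⟩ : ∃ j, Q *ᵥ Pi.single j 1 ≠ 0 := by
    by_contra! hcon
    refine hQ (Matrix.ext fun i j => ?_)
    simpa using congrFun (hcon j) i
  refine lt_of_lt_of_le ((norm_pos_iff.2 hj).trans_le (norm_le_l1norm _))
    (le_opNormInfToOne Q ?_)
  rw [linfnorm_eq_norm, Pi.norm_single, norm_one]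

lemma cConst_pos {m n q : ℕ} (hm : 0 < m) {A : Matrix (Fin m) (Fin n) ℝ}
    {M : Matrix (Fin m) (Fin q) ℝ} (hA : A.rank = m) (hM : M.rank = m) : 0 < cConst M A := by
  obtain ⟨g, hg, hu⟩ := exists_isUnit_submatrix_of_rank_eq hM
  have hAA : IsUnit (A * Aᵀ) := by
    obtain ⟨e, he, hue⟩ := exists_isUnit_submatrix_of_rank_eq
      (M := A * Aᵀ) ((rank_self_mul_transpose A).trans hA)
    have := (isUnit_submatrix_equiv (A := A * Aᵀ) (Equiv.refl _)
      (Equiv.ofBijective e (Finite.injective_iff_bijective.1 he))).1 hue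
    exact this
  have hQ : (M.submatrix id g)⁻¹ * (A * Aᵀ)⁻¹ * A ≠ 0 := by
    intro h0
    have h1 : (A * Aᵀ) * ((M.submatrix id g) * ((M.submatrix id g)⁻¹ * (A * Aᵀ)⁻¹ * A)) = A := by
      rw [Matrix.mul_assoc (M.submatrix id g)⁻¹,
        mul_nonsing_inv_cancel_left _ _ ((isUnit_iff_isUnit_det _).1 hu),
        mul_nonsing_inv_cancel_left _ _ ((isUnit_iff_isUnit_det _).1 hAA)]
    rw [h0, Matrix.mul_zero, Matrix.mul_zero] at h1
    rw [← h1, rank_zero] at hA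
    omega
  refine (opNormInfToOne_pos hQ).trans_le (le_csSup ?_ ⟨g, hg, hu, rfl⟩)
  refine ((Set.finite_range fun g : Fin m → Fin q =>
    opNormInfToOne ((M.submatrix id g)⁻¹ * (A * Aᵀ)⁻¹ * A)).subset ?_).bddAbove
  rintro t ⟨g, -, -, rfl⟩
  exact ⟨g, rfl⟩

/-- The robust form of the null space property. -/
lemma RIP.exists_norm_le {m n q k : ℕ} {A : Matrix (Fin m) (Fin n) ℝ}
    {M : Matrix (Fin m) (Fin q) ℝ} (hM : M.rank = m) {δ : ℝ} (hδ0 : 0 < δ)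
    (hδ : δ < 1 / Real.sqrt 2) (hRIP : RIP A (2 * k) δ) :
    ∃ C : ℝ, 0 < C ∧ ∀ S : Finset (Fin n), S.card ≤ k → ∀ h : Fin n → ℝ,
      ‖h‖ ≤ C * (max (∑ i ∈ Sᶜ, |h i| - ∑ i ∈ S, |h i|) 0 + ‖Mᵀ *ᵥ (A *ᵥ h)‖) := by
  have hex : ∀ S : Finset (Fin n), ∃ C : ℝ, 0 < C ∧ (S.card ≤ k → ∀ h : Fin n → ℝ,
      ‖h‖ ≤ C * (max (∑ i ∈ Sᶜ, |h i| - ∑ i ∈ S, |h i|) 0 + ‖Mᵀ *ᵥ (A *ᵥ h)‖)) := by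
    intro S
    by_cases hS : S.card ≤ k
    · obtain ⟨C, hC, hle⟩ := exists_norm_le_mul_of_homogeneous (f := fun h : Fin n → ℝ =>
        max (∑ i ∈ Sᶜ, |h i| - ∑ i ∈ S, |h i|) 0 + ‖Mᵀ *ᵥ (A *ᵥ h)‖) (by fun_prop)
        (fun t ht x => by
          simp only [Pi.smul_apply, smul_eq_mul, abs_mul, ← Finset.mul_sum, abs_of_nonneg ht,
            ← mul_sub, mulVec_smul, norm_smul, Real.norm_eq_abs, mul_add, mul_max_of_nonneg _ _ ht,
            mul_zero])
        (fun x hx => by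
          by_contra! hcon
          have h1 := le_max_right (∑ i ∈ Sᶜ, |x i| - ∑ i ∈ S, |x i|) 0
          have h2 := le_max_left (∑ i ∈ Sᶜ, |x i| - ∑ i ∈ S, |x i|) 0
          have h3 := norm_nonneg (Mᵀ *ᵥ (A *ᵥ x))
          refine hx (hRIP.null_space_property hδ0 hδ hS
            (mulVec_transpose_eq_zero_of_rank_eq hM (norm_eq_zero.1 ?_)) ?_) <;> linarith)
      exact ⟨C, hC, fun _ => hle⟩
    · exact ⟨1, one_pos, fun h => absurd h hS⟩
  choose C hC hle using hex
  refine ⟨∑ S, C S, Finset.sum_pos (fun S _ => hC S) Finset.univ_nonempty, fun S hS h =>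
    (hle S hS h).trans (mul_le_mul_of_nonneg_right ?_ (by positivity))⟩
  exact Finset.single_le_sum (fun S _ => (hC S).le) (Finset.mem_univ S)

lemma continuous_resid {m n q : ℕ} (A : Matrix (Fin m) (Fin n) ℝ) (M : Matrix (Fin m) (Fin q) ℝ)
    (y : Fin m → ℝ) : Continuous (resid A M y) := by
  unfold resid
  fun_prop

lemma mulVec_transpose_mulVec_sub {m n q : ℕ} (A : Matrix (Fin m) (Fin n) ℝ)
    (M : Matrix (Fin m) (Fin q) ℝ) (y : Fin m → ℝ) (x z : Fin n → ℝ) :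
    Mᵀ *ᵥ (A *ᵥ (x - z)) = resid A M y x - resid A M y z := by
  simp only [resid, mulVec_sub]
  abel

lemma norm_le_linfnorm_add_l1norm {n : ℕ} {α : ℝ} (hα : α ≤ 1) (r : Fin n → ℝ) :
    ‖r‖ ≤ α * linfnorm r + (1 - α) * l1norm r := by
  have := mul_le_mul_of_nonneg_left (norm_le_l1norm r) (sub_nonneg.2 hα)
  rw [linfnorm_eq_norm]
  linarith

lemma exists_l1norm_minimizer {n : ℕ} {F : Set (Fin n → ℝ)} (hF : IsClosed F) {x : Fin n → ℝ}
    (hx : x ∈ F) : ∃ z ∈ F, ∀ w ∈ F, l1norm z ≤ l1norm w := by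
  have hK : IsCompact (F ∩ {z | l1norm z ≤ l1norm x}) := by
    refine (isCompact_closedBall (0 : Fin n → ℝ) (l1norm x)).of_isClosed_subset
      (hF.inter (isClosed_le continuous_l1norm continuous_const)) fun z hz => ?_
    simpa using (norm_le_l1norm z).trans hz.2
  obtain ⟨z, hz, hmin⟩ := hK.exists_isMinOn ⟨x, hx, le_refl (l1norm x)⟩ continuous_l1norm.continuousOn
  refine ⟨z, hz.1, fun w hw => ?_⟩
  rcases le_total (l1norm w) (l1norm x) with h | h
  · exact hmin ⟨hw, h⟩
  · exact le_trans hz.2 h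

/-- If `z` has smaller `ℓ₁` norm than `x`, then `x - z` concentrates on any set carrying most of
`x`. -/
lemma sum_compl_sub_sum_le_of_l1norm_le {n : ℕ} {x z u : Fin n → ℝ} (hz : l1norm z ≤ l1norm x)
    {S : Finset (Fin n)} (hS : ∀ i ∉ S, u i = 0) :
    ∑ i ∈ Sᶜ, |(x - z) i| - ∑ i ∈ S, |(x - z) i| ≤ 2 * l1norm (x - u) := by
  unfold l1norm at *
  rw [← Finset.sum_add_sum_compl S, ← Finset.sum_add_sum_compl S (fun i => |x i|)] at hz
  rw [← Finset.sum_add_sum_compl S (fun i => |(x - u) i|)]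
  have h1 : ∑ i ∈ S, |x i| ≤ ∑ i ∈ S, |z i| + ∑ i ∈ S, |(x - z) i| := by
    rw [← Finset.sum_add_distrib]
    refine Finset.sum_le_sum fun i _ => ?_
    simpa using abs_add_le (z i) (x i - z i)
  have h2 : ∑ i ∈ Sᶜ, |(x - z) i| ≤ ∑ i ∈ Sᶜ, |x i| + ∑ i ∈ Sᶜ, |z i| := by
    rw [← Finset.sum_add_distrib]
    exact Finset.sum_le_sum fun i _ => abs_sub _ _
  have h3 : ∑ i ∈ Sᶜ, |(x - u) i| = ∑ i ∈ Sᶜ, |x i| :=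
    Finset.sum_congr rfl fun i hi => by simp [hS i (Finset.mem_compl.1 hi)]
  have h4 := Finset.sum_nonneg fun i (_ : i ∈ S) => abs_nonneg ((x - u) i)
  linarith

lemma cConst_nonneg {m n q : ℕ} (M : Matrix (Fin m) (Fin q) ℝ) (A : Matrix (Fin m) (Fin n) ℝ) :
    0 ≤ cConst M A := by
  refine Real.sSup_nonneg ?_
  rintro t ⟨g, -, -, rfl⟩
  refine Real.sSup_nonneg ?_
  rintro t ⟨x, -, rfl⟩
  exact l1norm_nonneg _

/-- Stability of the Dantzig selector under the RIP of order `2k` with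
constant `δ_{2k} < 1/√2`. -/
theorem DS_stability_RIP (m n q k : ℕ) (hmn : m < n) (hmq : m ≤ q)
    (A : Matrix (Fin m) (Fin n) ℝ) (M : Matrix (Fin m) (Fin q) ℝ)
    (hArank : A.rank = m) (hMrank : M.rank = m)
    (y : Fin m → ℝ) (τ α : ℝ) (hτ : 0 ≤ τ) (hα0 : 0 ≤ α) (hα1 : α ≤ 1)
    (δ : ℝ) (hδ0 : 0 < δ) (hδ : δ < 1 / Real.sqrt 2) (hRIP : RIP A (2 * k) δ) :
    ∃ γ : ℝ, 0 < γ ∧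
      ∀ x : Fin n → ℝ,
        α * linfnorm (resid A M y x) + (1 - α) * l1norm (resid A M y x) ≤ τ →
        ∃ xstar : Fin n → ℝ,
          (α * linfnorm (resid A M y xstar) + (1 - α) * l1norm (resid A M y xstar) ≤ τ ∧
            ∀ z : Fin n → ℝ,
              α * linfnorm (resid A M y z) + (1 - α) * l1norm (resid A M y z) ≤ τ →
                l1norm xstar ≤ l1norm z) ∧
          l2norm (x - xstar) ≤ 2 * γ * (bestKTerm k x + cConst M A * τ) := by
  obtain ⟨C, hC, hbound⟩ := hRIP.exists_norm_le hMrank hδ0 hδ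
  have hcτ : 0 ≤ cConst M A * τ := mul_nonneg (cConst_nonneg M A) hτ
  obtain ⟨K, hK, hτK⟩ : ∃ K : ℝ, 0 < K ∧ (0 < m → τ = K * (cConst M A * τ)) := by
    rcases Nat.eq_zero_or_pos m with h0 | hm
    · exact ⟨1, one_pos, fun h => absurd h0 h.ne'⟩
    · have hc := cConst_pos hm hArank hMrank
      exact ⟨(cConst M A)⁻¹, inv_pos.2 hc, fun _ => (inv_mul_cancel_left₀ hc.ne' τ).symm⟩
  have hn : (0 : ℝ) < Real.sqrt n := Real.sqrt_pos.2 (Nat.cast_pos.2 (by omega))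
  refine ⟨Real.sqrt n * (C * (1 + K)), by positivity, fun x hx => ?_⟩
  have hclosed : IsClosed {z : Fin n → ℝ |
      α * linfnorm (resid A M y z) + (1 - α) * l1norm (resid A M y z) ≤ τ} := by
    have h1 := continuous_l1norm.comp (continuous_resid A M y)
    have h2 := (continuous_resid A M y).norm
    simp only [linfnorm_eq_norm]
    exact isClosed_le ((h2.const_mul α).add (h1.const_mul (1 - α))) continuous_const
  obtain ⟨z, hz, hmin⟩ := exists_l1norm_minimizer hclosed hx
  refine ⟨z, ⟨hz, hmin⟩, ?_⟩
  have hres : ‖Mᵀ *ᵥ (A *ᵥ (x - z))‖ ≤ 2 * (K * (cConst M A * τ)) := by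
    rcases Nat.eq_zero_or_pos m with rfl | hm
    · rw [Subsingleton.elim (A *ᵥ (x - z)) 0, mulVec_zero, norm_zero]
      positivity
    · rw [mulVec_transpose_mulVec_sub A M y, ← hτK hm]
      have h1 := (norm_le_linfnorm_add_l1norm hα1 (resid A M y x)).trans hx
      have h2 := (norm_le_linfnorm_add_l1norm hα1 (resid A M y z)).trans hz
      linarith [norm_sub_le (resid A M y x) (resid A M y z)]
  have hγ : 0 < 2 * (Real.sqrt n * (C * (1 + K))) := by positivity
  rw [← div_le_iff₀' hγ, ← sub_le_iff_le_add]
  refine le_csInf ⟨_, 0, by simp, rfl⟩ ?_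
  rintro t ⟨u, hu, rfl⟩
  rw [sub_le_iff_le_add, div_le_iff₀' hγ]
  have hsum := sum_compl_sub_sum_le_of_l1norm_le (hmin x hx) (u := u)
    (S := Finset.univ.filter fun i => u i ≠ 0) (by simp)
  have hu0 := l1norm_nonneg (x - u)
  calc l2norm (x - z) ≤ Real.sqrt n * ‖x - z‖ := l2norm_le_sqrt_card_mul_norm _
    _ ≤ Real.sqrt n * (C * (2 * l1norm (x - u) + 2 * (K * (cConst M A * τ)))) := by
        gcongr
        refine (hbound _ hu (x - z)).trans ?_
        gcongr
        exact max_le hsum (by positivity)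
    _ ≤ Real.sqrt n * (C * (2 * ((1 + K) * (l1norm (x - u) + cConst M A * τ)))) := by
        gcongr
        nlinarith [mul_nonneg hK.le hu0]
    _ = 2 * (Real.sqrt n * (C * (1 + K))) * (l1norm (x - u) + cConst M A * τ) := by ring
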